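/- arXiv:math/0011020 — 6 statements merged into one kernel-verified Lean document; each statement's English description precedes it below -/
import Mathlib

section
/- For all natural numbers d ≥ 1 and n, the number of functions f : ZMod d → Fin n that are surjective and aperiodic (meaning that for every k ∈ ZMod d with k ≠ 0, the function x ↦ f(x + k) is not equal to f) equals ∑_{j | d} μ(j) · Surj(d/j, n), as integers, where the sum runs over the positive divisors j of d. -/
open ArithmeticFunction

/-- `Surj d n` is the number of surjective functions from `Fin d` to `Fin n`. -/
noncomputable def Surj (d n : ℕ) : ℕ := Nat.card {f : Fin d → Fin n // Function.Surjective f}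

/-- `f : ZMod d → Fin n` is aperiodic if no nontrivial rotation fixes it. -/
def Aperiodic (d n : ℕ) (f : ZMod d → Fin n) : Prop :=
  ∀ k : ZMod d, k ≠ 0 → (fun x => f (x + k)) ≠ f

open Function

/-- The shift map on sequences. -/
def seqShift {α : Type*} (g : ℕ → α) : ℕ → α := fun x => g (x + 1)

theorem seqShift_iterate {α : Type*} (k : ℕ) (g : ℕ → α) (x : ℕ) :
    seqShift^[k] g x = g (x + k) := by
  induction k generalizing x with
  | zero => rfl
  | succ k ih =>
    rw [iterate_succ_apply', seqShift, ih, Nat.add_assoc, Nat.add_comm 1 k]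

theorem isPeriodicPt_seqShift_iff {α : Type*} {k : ℕ} {g : ℕ → α} :
    IsPeriodicPt seqShift k g ↔ g.Periodic k := by
  simp only [IsPeriodicPt, IsFixedPt, funext_iff, seqShift_iterate, Periodic]

/-- Functions on `ZMod d` are the same as sequences of period `d`. -/
def zmodFunEquivPeriodic (α : Type*) (d : ℕ) [NeZero d] :
    (ZMod d → α) ≃ {g : ℕ → α // IsPeriodicPt seqShift d g} where
  toFun f := ⟨fun x => f x, isPeriodicPt_seqShift_iff.2 fun x => by simp⟩
  invFun g := fun x => g.1 x.val
  left_inv f := by ext x; simp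
  right_inv g := by
    ext x
    simpa [ZMod.val_natCast] using (isPeriodicPt_seqShift_iff.1 g.2).map_mod_nat x

theorem surjective_comp_natCast_iff {α : Type*} {d : ℕ} [NeZero d] {f : ZMod d → α} :
    Surjective (fun x : ℕ => f x) ↔ Surjective f :=
  (ZMod.natCast_zmod_surjective (n := d)).of_comp_iff f

theorem aperiodic_iff_minimalPeriod {d n : ℕ} [NeZero d] {f : ZMod d → Fin n} :
    Aperiodic d n f ↔ minimalPeriod seqShift (fun x : ℕ => f x) = d := by
  have hper := (zmodFunEquivPeriodic (Fin n) d f).2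
  constructor
  · intro h
    refine Nat.dvd_antisymm hper.minimalPeriod_dvd ?_
    rw [← ZMod.natCast_eq_zero_iff]
    by_contra hp
    refine h _ hp (funext fun x => ?_)
    have := isPeriodicPt_seqShift_iff.1
      (isPeriodicPt_minimalPeriod seqShift (fun x : ℕ => f x)) x.val
    simpa using this
  · intro h k hk hf
    have : IsPeriodicPt seqShift k.val (fun x : ℕ => f x) :=
      isPeriodicPt_seqShift_iff.2 fun x => by simpa using congrFun hf x
    have hdvd := this.minimalPeriod_dvd
    rw [h] at hdvd
    exact hk ((ZMod.val_eq_zero k).1 (Nat.eq_zero_of_dvd_of_lt hdvd k.val_lt))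

/-- Aperiodic surjections on `ZMod d` are the same as surjective sequences of minimal period `d`. -/
def aperiodicSurjectionEquiv (d n : ℕ) [NeZero d] :
    {f : ZMod d → Fin n // Surjective f ∧ Aperiodic d n f} ≃
      {g : ℕ → Fin n // Surjective g ∧ minimalPeriod seqShift g = d} :=
  ((zmodFunEquivPeriodic (Fin n) d).subtypeEquiv
    (q := fun g => Surjective g.1 ∧ minimalPeriod seqShift g.1 = d) fun _ =>
      and_congr surjective_comp_natCast_iff.symm aperiodic_iff_minimalPeriod).trans
    (Equiv.subtypeSubtypeEquivSubtype
      (q := fun g : ℕ → Fin n => Surjective g ∧ minimalPeriod seqShift g = d) fun h =>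
        isPeriodicPt_iff_minimalPeriod_dvd.2 h.2.dvd)

/-- Surjections on `ZMod d` are the same as surjective sequences of period `d`. -/
def surjectionEquiv (d n : ℕ) [NeZero d] :
    {f : ZMod d → Fin n // Surjective f} ≃
      {g : ℕ → Fin n // IsPeriodicPt seqShift d g ∧ Surjective g} :=
  ((zmodFunEquivPeriodic (Fin n) d).subtypeEquiv
    (q := fun g => Surjective g.1) fun _ => surjective_comp_natCast_iff.symm).trans
    (Equiv.subtypeSubtypeEquivSubtypeInter _ _)

/-- Surjective sequences of period `d`, sorted by their minimal period. -/
noncomputable def periodicSurjectionEquivSigma (d n : ℕ) [NeZero d] :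
    {g : ℕ → Fin n // IsPeriodicPt seqShift d g ∧ Surjective g} ≃
      Σ e : d.divisors, {g : ℕ → Fin n // Surjective g ∧ minimalPeriod seqShift g = e} where
  toFun g := ⟨⟨minimalPeriod seqShift g.1,
    Nat.mem_divisors.2 ⟨g.2.1.minimalPeriod_dvd, NeZero.ne d⟩⟩, g.1, g.2.2, rfl⟩
  invFun g := ⟨g.2.1, isPeriodicPt_iff_minimalPeriod_dvd.2
    (g.2.2.2.dvd.trans (Nat.dvd_of_mem_divisors g.1.2)), g.2.2.1⟩
  left_inv _ := rfl
  right_inv := by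
    rintro ⟨⟨e, he⟩, g, h⟩
    obtain rfl : minimalPeriod seqShift g = e := h.2
    rfl

theorem Surj_eq_card_zmod (d n : ℕ) [NeZero d] :
    Surj d n = Nat.card {f : ZMod d → Fin n // Surjective f} :=
  Nat.card_congr (((ZMod.finEquiv d).toEquiv.arrowCongr (Equiv.refl _)).subtypeEquiv fun f =>
    ((ZMod.finEquiv d).symm.surjective.of_comp_iff f).symm)

theorem sum_card_aperiodic_surjections (d n : ℕ) (hd : 0 < d) :
    ∑ e ∈ d.divisors, Nat.card {f : ZMod e → Fin n // Surjective f ∧ Aperiodic e n f} =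
      Surj d n := by
  have : NeZero d := ⟨hd.ne'⟩
  have hne (e : d.divisors) : NeZero (e : ℕ) := ⟨(Nat.pos_of_mem_divisors e.2).ne'⟩
  have hfin (e : d.divisors) :
      Finite {g : ℕ → Fin n // Surjective g ∧ minimalPeriod seqShift g = e} :=
    Finite.of_equiv _ (aperiodicSurjectionEquiv e n)
  rw [Surj_eq_card_zmod, Nat.card_congr (surjectionEquiv d n),
    Nat.card_congr (periodicSurjectionEquivSigma d n), Nat.card_sigma, ← Finset.sum_coe_sort]
  exact Finset.sum_congr rfl fun e _ => Nat.card_congr (aperiodicSurjectionEquiv e n)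

/-- For `d ≥ 1`, the number of aperiodic surjections `ZMod d → Fin n` equals
`∑_{j | d} μ(j) · Surj(d/j, n)`. -/
theorem card_aperiodic_surjections (d n : ℕ) (hd : 1 ≤ d) :
    (Nat.card {f : ZMod d → Fin n // Function.Surjective f ∧ Aperiodic d n f} : ℤ) =
      ∑ j ∈ d.divisors, (moebius j) * (Surj (d / j) n : ℤ) := by
  have h := (sum_eq_iff_sum_mul_moebius_eq (R := ℤ)
    (f := fun e => (Nat.card {f : ZMod e → Fin n // Surjective f ∧ Aperiodic e n f} : ℤ))
    (g := fun e => (Surj e n : ℤ))).1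
    (fun m hm => mod_cast sum_card_aperiodic_surjections m n hm) d hd
  simp only [Int.cast_id] at h
  rw [← h, Nat.sum_divisorsAntidiagonal fun i j => moebius i * (Surj j n : ℤ)]
end

section
/- For all natural numbers d ≥ 1 and n, the integer d divides ∑_{j | d} μ(j) · Surj(d/j, n), where the sum runs over the positive divisors j of d. (Consequently the rank R(d,n) = (1/d) ∑_{j|d} μ(j) Surj(d/j,n) is a nonnegative integer.) -/
open ArithmeticFunction

open Function

/-- The number of points of minimal period `d` is divisible by `d`, as these points split into
orbits of size `d`. -/
theorem dvd_ncard_minimalPeriod_eq {α : Type*} (f : α → α) {d : ℕ} (hd : 0 < d) :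
    d ∣ {x | minimalPeriod f x = d}.ncard := by
  classical
  rcases Set.finite_or_infinite {x | minimalPeriod f x = d} with hfin | hinf
  swap
  · simp [hinf.ncard]
  have hper {x : α} (hx : minimalPeriod f x = d) : x ∈ periodicPts f :=
    minimalPeriod_pos_iff_mem_periodicPts.1 (hx ▸ hd)
  rw [Set.ncard_eq_toFinset_card _ hfin,
    Finset.card_eq_sum_card_image (periodicOrbit f) hfin.toFinset]
  refine Finset.dvd_sum fun c hc => ?_
  obtain ⟨x, hx, rfl⟩ := Finset.mem_image.1 hc
  replace hx : minimalPeriod f x = d := by simpa using hx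
  have hfiber : {y ∈ hfin.toFinset | periodicOrbit f y = periodicOrbit f x} =
      (Finset.range d).image (f^[·] x) := by
    ext y
    simp only [Finset.mem_filter, Set.Finite.mem_toFinset, Set.mem_ofPred_eq, Finset.mem_image,
      Finset.mem_range]
    constructor
    · rintro ⟨hy, hyx⟩
      obtain ⟨k, rfl⟩ := (mem_periodicOrbit_iff (hper hx)).1
        (hyx ▸ self_mem_periodicOrbit (hper hy))
      exact ⟨k % d, Nat.mod_lt k hd, hx ▸ iterate_mod_minimalPeriod_eq⟩
    · rintro ⟨k, -, rfl⟩
      exact ⟨(minimalPeriod_apply_iterate (hper hx) k).trans hx,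
        periodicOrbit_apply_iterate_eq (hper hx) k⟩
  have hinj : Set.InjOn (f^[·] x) (Finset.range d) := by
    rw [Finset.coe_range, ← hx]
    exact iterate_injOn_Iio_minimalPeriod
  rw [hfiber, Finset.card_image_of_injOn hinj, Finset.card_range]

/-- Points of period `d` are classified by their minimal period. -/
theorem sum_ncard_minimalPeriod_eq {α : Type*} (f : α → α) {d : ℕ} (hd : 0 < d)
    (hfin : (ptsOfPeriod f d).Finite) :
    ∑ e ∈ d.divisors, {x | minimalPeriod f x = e}.ncard = (ptsOfPeriod f d).ncard := by
  classical
  rw [Set.ncard_eq_toFinset_card _ hfin,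
    Finset.card_eq_sum_card_fiberwise (f := minimalPeriod f) (t := d.divisors)]
  · refine Finset.sum_congr rfl fun e he => ?_
    rw [← Set.ncard_coe_finset]
    congr 1
    ext x
    simp only [Set.mem_ofPred_eq, Finset.coe_filter, Set.Finite.mem_toFinset, mem_ptsOfPeriod,
      isPeriodicPt_iff_minimalPeriod_dvd]
    exact ⟨fun h => ⟨h ▸ Nat.dvd_of_mem_divisors he, h⟩, And.right⟩
  · intro x hx
    simpa [isPeriodicPt_iff_minimalPeriod_dvd, hd.ne'] using hx

/-- The Gauss congruences for the numbers of periodic points of a self-map. -/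
theorem dvd_sum_moebius_mul_ncard_ptsOfPeriod {α : Type*} (f : α → α)
    (hfin : ∀ m > 0, (ptsOfPeriod f m).Finite) {d : ℕ} (hd : 0 < d) :
    (d : ℤ) ∣ ∑ j ∈ d.divisors, moebius j * ((ptsOfPeriod f (d / j)).ncard : ℤ) := by
  have h := (sum_eq_iff_sum_mul_moebius_eq
    (f := fun e => ({x | minimalPeriod f x = e}.ncard : ℤ))
    (g := fun m => ((ptsOfPeriod f m).ncard : ℤ))).1
    (fun m hm => by exact_mod_cast sum_ncard_minimalPeriod_eq f hm (hfin m hm)) d hd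
  simp only [Int.cast_id] at h
  rw [Nat.sum_divisorsAntidiagonal
    (fun i j => moebius i * ((ptsOfPeriod f j).ncard : ℤ))] at h
  rw [h]
  exact_mod_cast dvd_ncard_minimalPeriod_eq f hd

theorem Function.Periodic.apply_emod {β : Type*} {g : ℤ → β} {c : ℤ} (hg : Periodic g c) (i : ℤ) :
    g (i % c) = g i := by
  rw [Int.emod_def, mul_comm]
  exact hg.sub_int_mul_eq (i / c)

/-- The shift on surjective bi-infinite sequences. -/
def surjShift (β : Type*) (x : {x : ℤ → β // Surjective x}) : {x : ℤ → β // Surjective x} :=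
  ⟨fun i => x.1 (i + 1), x.2.comp (Equiv.addRight (1 : ℤ)).surjective⟩

theorem surjShift_iterate_apply {β : Type*} (m : ℕ) (x : {x : ℤ → β // Surjective x}) (i : ℤ) :
    ((surjShift β)^[m] x).1 i = x.1 (i + m) := by
  induction m generalizing x with
  | zero => simp
  | succ m ih =>
    rw [iterate_succ_apply, ih]
    simp [surjShift, add_assoc]

theorem isPeriodicPt_surjShift_iff {β : Type*} {m : ℕ} {x : {x : ℤ → β // Surjective x}} :
    IsPeriodicPt (surjShift β) m x ↔ Periodic x.1 m := by
  rw [IsPeriodicPt, IsFixedPt, Subtype.ext_iff, funext_iff]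
  simp only [surjShift_iterate_apply, Periodic]

/-- Surjective sequences of period `m` correspond to surjective functions on `Fin m`. -/
def ptsOfPeriodSurjShiftEquiv (β : Type*) (m : ℕ) [NeZero m] :
    ptsOfPeriod (surjShift β) m ≃ {g : Fin m → β // Surjective g} where
  toFun x := ⟨fun i => x.1.1 i, fun b => by
    obtain ⟨i, rfl⟩ := x.1.2 b
    have hm : (0 : ℤ) < m := by exact_mod_cast NeZero.pos m
    refine ⟨⟨(i % m).toNat, by have := Int.emod_lt_of_pos i hm; omega⟩, ?_⟩
    simp only [Int.toNat_of_nonneg (Int.emod_nonneg i hm.ne')]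
    exact (isPeriodicPt_surjShift_iff.1 x.2).apply_emod i⟩
  invFun g := ⟨⟨fun i => g.1 ⟨(i % m).toNat, by
      have hm : (0 : ℤ) < m := by exact_mod_cast NeZero.pos m
      have := Int.emod_lt_of_pos i hm
      omega⟩, fun b => by
        obtain ⟨i, rfl⟩ := g.2 b
        refine ⟨i, congrArg g.1 (Fin.ext ?_)⟩
        have := Nat.mod_eq_of_lt i.2
        simp only
        omega⟩,
    isPeriodicPt_surjShift_iff.2 fun i => by simp⟩
  left_inv x := by
    have hm : (m : ℤ) ≠ 0 := by exact_mod_cast NeZero.ne m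
    refine Subtype.ext (Subtype.ext (funext fun i => ?_))
    simp only [Int.toNat_of_nonneg (Int.emod_nonneg i hm)]
    exact (isPeriodicPt_surjShift_iff.1 x.2).apply_emod i
  right_inv g := by
    refine Subtype.ext (funext fun i => congrArg g.1 (Fin.ext ?_))
    have := Nat.mod_eq_of_lt i.2
    simp only
    omega

/-- For `d ≥ 1`, the integer `d` divides `∑_{j | d} μ(j) · Surj(d/j, n)`. -/
theorem dvd_moebius_surj_sum (d n : ℕ) (hd : 1 ≤ d) :
    (d : ℤ) ∣ ∑ j ∈ d.divisors, (moebius j) * (Surj (d / j) n : ℤ) := by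
  have hfin (m : ℕ) (hm : m > 0) : (ptsOfPeriod (surjShift (Fin n)) m).Finite := by
    have : NeZero m := ⟨hm.ne'⟩
    exact Finite.of_equiv _ (ptsOfPeriodSurjShiftEquiv (Fin n) m).symm
  convert dvd_sum_moebius_mul_ncard_ptsOfPeriod (surjShift (Fin n)) hfin hd using 4 with j hj
  have : NeZero (d / j) := ⟨(Nat.div_pos (Nat.divisor_le hj) (Nat.pos_of_mem_divisors hj)).ne'⟩
  exact (Nat.card_congr (ptsOfPeriodSurjShiftEquiv (Fin n) (d / j))).symm
end

section
/- For all natural numbers d ≥ 1 and n, letting the group ZMod d act on the set of aperiodic surjective functions f : ZMod d → Fin n by rotation (k · f = fun x => f (x + k)), the number of orbits of this action, multiplied by d, equals ∑_{j | d} μ(j) · Surj(d/j, n); that is, the number of cyclic-rotation equivalence classes of aperiodic surjections equals (1/d) ∑_{j|d} μ(j) Surj(d/j, n). -/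
open ArithmeticFunction

/-- The set of aperiodic surjective functions `ZMod d → Fin n`. -/
abbrev AperiodicSurj (d n : ℕ) : Type :=
  {f : ZMod d → Fin n // Function.Surjective f ∧ Aperiodic d n f}

/-- Rotation equivalence on aperiodic surjections: `f ≈ g` iff `g = fun x => f (x + k)`
for some `k : ZMod d`. -/
def RotEquiv (d n : ℕ) (f g : AperiodicSurj d n) : Prop :=
  ∃ k : ZMod d, (g : ZMod d → Fin n) = fun x => (f : ZMod d → Fin n) (x + k)

/-- Rotation of an aperiodic surjection by `k`. -/
def AperiodicSurj.rotate {d n : ℕ} (f : AperiodicSurj d n) (k : ZMod d) : AperiodicSurj d n :=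
  ⟨fun x => f.1 (x + k), f.2.1.comp (Equiv.addRight k).surjective,
    fun l hl h => f.2.2 l hl <| by
      funext x
      have := congrFun h (x - k)
      simp only at this
      rwa [show x - k + l + k = x + l by ring, sub_add_cancel] at this⟩

theorem rotEquiv_iff_exists_rotate {d n : ℕ} (f g : AperiodicSurj d n) :
    RotEquiv d n f g ↔ ∃ k, g = f.rotate k :=
  ⟨fun ⟨k, h⟩ => ⟨k, Subtype.ext h⟩, fun ⟨k, h⟩ => ⟨k, congrArg Subtype.val h⟩⟩

theorem AperiodicSurj.rotate_rotate {d n : ℕ} (f : AperiodicSurj d n) (k l : ZMod d) :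
    (f.rotate k).rotate l = f.rotate (l + k) :=
  Subtype.ext <| funext fun x => congrArg f.1 (add_assoc x l k)

theorem AperiodicSurj.rotate_zero {d n : ℕ} (f : AperiodicSurj d n) : f.rotate 0 = f :=
  Subtype.ext <| funext fun x => congrArg f.1 (add_zero x)

theorem AperiodicSurj.rotate_injective {d n : ℕ} (f : AperiodicSurj d n) :
    Function.Injective f.rotate := by
  intro k l h
  by_contra hkl
  refine f.2.2 (k - l) (sub_ne_zero.mpr hkl) (funext fun x => ?_)
  have := congrFun (congrArg Subtype.val h) (x - l)
  simp only [AperiodicSurj.rotate, sub_add_cancel] at this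
  rwa [show x - l + k = x + (k - l) by ring] at this

theorem rotEquiv_equivalence (d n : ℕ) : Equivalence (RotEquiv d n) where
  refl f := (rotEquiv_iff_exists_rotate f f).mpr ⟨0, f.rotate_zero.symm⟩
  symm {f g} h := by
    obtain ⟨k, rfl⟩ := (rotEquiv_iff_exists_rotate f g).mp h
    refine (rotEquiv_iff_exists_rotate _ f).mpr ⟨-k, ?_⟩
    rw [f.rotate_rotate, neg_add_cancel, f.rotate_zero]
  trans {f g h} hfg hgh := by
    obtain ⟨k, rfl⟩ := (rotEquiv_iff_exists_rotate f g).mp hfg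
    obtain ⟨l, rfl⟩ := (rotEquiv_iff_exists_rotate _ h).mp hgh
    exact (rotEquiv_iff_exists_rotate f _).mpr ⟨l + k, f.rotate_rotate k l⟩

/-- Every orbit of aperiodic surjections under rotation has exactly `d` elements. -/
theorem card_quot_rotEquiv_mul (d n : ℕ) :
    Nat.card (Quot (RotEquiv d n)) * d = Nat.card (AperiodicSurj d n) := by
  have key : Function.Bijective
      fun p : Quot (RotEquiv d n) × ZMod d => AperiodicSurj.rotate p.1.out p.2 := by
    have mk_rotate (q : Quot (RotEquiv d n)) (k : ZMod d) :
        Quot.mk (RotEquiv d n) (AperiodicSurj.rotate q.out k) = q := by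
      conv_rhs => rw [← q.out_eq]
      exact (Quot.sound ((rotEquiv_iff_exists_rotate _ _).mpr ⟨k, rfl⟩)).symm
    constructor
    · rintro ⟨q, k⟩ ⟨r, l⟩ h
      obtain rfl : q = r := by
        rw [← mk_rotate q k, ← mk_rotate r l]
        exact congrArg _ h
      exact congrArg _ (AperiodicSurj.rotate_injective _ h)
    · intro f
      have h : RotEquiv d n (Quot.mk (RotEquiv d n) f).out f :=
        (rotEquiv_equivalence d n).quot_mk_eq_iff _ _ |>.mp (Quot.out_eq _)
      obtain ⟨k, hk⟩ := (rotEquiv_iff_exists_rotate _ _).mp h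
      exact ⟨(Quot.mk _ f, k), hk.symm⟩
  rw [← Nat.card_congr (Equiv.ofBijective _ key), Nat.card_prod, Nat.card_zmod]

/-- Pulling an aperiodic surjection on `ZMod e` back along `ZMod m → ZMod e` for `e ∣ m`. -/
def AperiodicSurj.pullback {m n : ℕ} (p : Σ e : m.divisors, AperiodicSurj e n) :
    {f : ZMod m → Fin n // Function.Surjective f} :=
  ⟨fun x => p.2.1 (ZMod.castHom (Nat.dvd_of_mem_divisors p.1.2) (ZMod p.1) x),
    p.2.2.1.comp (ZMod.castHom_surjective _)⟩

/-- The periods of the pullback of an aperiodic function on `ZMod e` are the multiples of `e`. -/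
theorem AperiodicSurj.pullback_periodic_iff {m n : ℕ} (p : Σ e : m.divisors, AperiodicSurj e n)
    (k : ℕ) : (∀ x, (pullback p).1 (x + k) = (pullback p).1 x) ↔ (p.1 : ℕ) ∣ k := by
  rw [← ZMod.natCast_eq_zero_iff]
  constructor
  · intro h
    by_contra hk
    refine p.2.2.2 k hk (funext fun y => ?_)
    obtain ⟨x, rfl⟩ := ZMod.castHom_surjective (Nat.dvd_of_mem_divisors p.1.2) y
    simpa only [pullback, map_add, map_natCast] using h x
  · intro h x
    simp only [pullback, map_add, map_natCast, h, add_zero]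

theorem AperiodicSurj.pullback_injective (m n : ℕ) :
    Function.Injective (pullback (m := m) (n := n)) := by
  intro p q h
  have hdvd (k : ℕ) : (p.1 : ℕ) ∣ k ↔ (q.1 : ℕ) ∣ k := by
    rw [← pullback_periodic_iff, ← pullback_periodic_iff, h]
  have he : p.1 = q.1 := Subtype.ext <|
    Nat.dvd_antisymm ((hdvd _).mpr dvd_rfl) ((hdvd _).mp dvd_rfl)
  obtain ⟨e, f⟩ := p
  obtain ⟨e', g⟩ := q
  obtain rfl : e = e' := he
  refine congrArg _ (Subtype.ext (funext fun y => ?_))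
  obtain ⟨x, rfl⟩ := ZMod.castHom_surjective (Nat.dvd_of_mem_divisors e.2) y
  exact congrFun (congrArg Subtype.val h) x

/-- The natural-number periods of a function on `ZMod m` are the multiples of a positive one. -/
theorem exists_pos_forall_periodic_iff_dvd {m : ℕ} (hm : 0 < m) {α : Type*} (f : ZMod m → α) :
    ∃ e : ℕ, 0 < e ∧ ∀ k : ℕ, (∀ x, f (x + k) = f x) ↔ e ∣ k := by
  classical
  have hex : ∃ e : ℕ, 0 < e ∧ Function.Periodic f (e : ZMod m) :=
    ⟨m, hm, fun x => by rw [ZMod.natCast_self, add_zero]⟩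
  obtain ⟨hpos, hper⟩ := Nat.find_spec hex
  set e := Nat.find hex
  have hmul (c : ℕ) : Function.Periodic f ((e * c : ℕ) : ZMod m) := by
    simpa [mul_comm] using hper.nat_mul c
  refine ⟨e, hpos, fun k => ⟨fun hk => ?_, ?_⟩⟩
  · by_contra hdvd
    refine Nat.find_min hex (Nat.mod_lt k hpos)
      ⟨Nat.pos_of_ne_zero fun h => hdvd (Nat.dvd_of_mod_eq_zero h), fun x => ?_⟩
    rw [← hmul (k / e), add_assoc, ← Nat.cast_add, Nat.mod_add_div, hk]
  · rintro ⟨c, rfl⟩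
    exact hmul c

theorem AperiodicSurj.pullback_surjective {m : ℕ} (hm : 0 < m) (n : ℕ) :
    Function.Surjective (pullback (m := m) (n := n)) := by
  rintro ⟨f, hf⟩
  obtain ⟨e, hpos, he⟩ := exists_pos_forall_periodic_iff_dvd hm f
  have hem : e ∣ m := (he m).mp fun x => by rw [ZMod.natCast_self, add_zero]
  have : NeZero m := ⟨hm.ne'⟩
  have : NeZero e := ⟨hpos.ne'⟩
  have hg (x : ZMod m) : f ((ZMod.castHom hem (ZMod e) x).val : ZMod m) = f x := by
    obtain ⟨a, rfl⟩ := ZMod.natCast_zmod_surjective x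
    rw [map_natCast, ZMod.val_natCast, ← (he _).mpr (dvd_mul_right e (a / e)), ← Nat.cast_add,
      Nat.mod_add_div]
  refine ⟨⟨⟨e, Nat.mem_divisors.mpr ⟨hem, hm.ne'⟩⟩, fun y => f (y.val : ZMod m), ?_, ?_⟩,
    Subtype.ext (funext hg)⟩
  · intro b
    obtain ⟨x, rfl⟩ := hf b
    exact ⟨_, hg x⟩
  · intro k hk h
    refine hk ((ZMod.val_eq_zero k).mp (Nat.eq_zero_of_dvd_of_lt ((he _).mp fun x => ?_) k.val_lt))
    have := congrFun h (ZMod.castHom hem (ZMod e) x)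
    rw [← hg x, ← this, ← hg, map_add, map_natCast, ZMod.natCast_zmod_val]

theorem sum_card_aperiodicSurj {m : ℕ} (hm : 0 < m) (n : ℕ) :
    ∑ e ∈ m.divisors, Nat.card (AperiodicSurj e n) = Surj m n := by
  have : NeZero m := ⟨hm.ne'⟩
  have hfin (e : m.divisors) : Finite (AperiodicSurj e n) := by
    have : NeZero (e : ℕ) := ⟨(Nat.pos_of_mem_divisors e.2).ne'⟩
    infer_instance
  have hsurj : Surj m n = Nat.card {f : ZMod m → Fin n // Function.Surjective f} :=
    Nat.card_congr <| ((ZMod.finEquiv m).toEquiv.arrowCongr (Equiv.refl _)).subtypeEquiv fun f => by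
      simp [Equiv.arrowCongr]
  rw [hsurj, ← Nat.card_congr (Equiv.ofBijective _
    ⟨AperiodicSurj.pullback_injective m n, AperiodicSurj.pullback_surjective hm n⟩),
    Nat.card_sigma, Finset.sum_coe_sort m.divisors fun e => Nat.card (AperiodicSurj e n)]

/-- For `d ≥ 1`, `d` times the number of cyclic-rotation equivalence classes of
aperiodic surjections `ZMod d → Fin n` equals `∑_{j | d} μ(j) · Surj(d/j, n)`. -/
theorem card_orbits_aperiodic_surjections (d n : ℕ) (hd : 1 ≤ d) :
    (Nat.card (Quot (RotEquiv d n)) : ℤ) * d =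
      ∑ j ∈ d.divisors, (moebius j) * (Surj (d / j) n : ℤ) := by
  have hinv := (sum_eq_iff_sum_mul_moebius_eq (R := ℤ)
    (f := fun e => (Nat.card (AperiodicSurj e n) : ℤ)) (g := fun e => (Surj e n : ℤ))).mp
    (fun m hm => by exact_mod_cast sum_card_aperiodicSurj hm n) d hd
  rw [← Nat.cast_mul, card_quot_rotEquiv_mul, ← hinv]
  simp only [Int.cast_id]
  exact Nat.sum_divisorsAntidiagonal fun i j => moebius i * (Surj j n : ℤ)
end

section
/- For every n ≥ 1 and every ℓ with 0 ≤ ℓ ≤ n+1, there exists a (necessarily unique) Lie algebra homomorphism ∂^ℓ : B_n → B_{n+1} over ℚ satisfying, on the classes of the generators: ∂^ℓ(x_{ij}) = x_{σ^ℓ(i) σ^ℓ(j)} whenever i, j ≠ ℓ, and ∂^ℓ(x_{ℓ j}) = x_{ℓ, σ^ℓ(j)} + x_{ℓ+1, σ^ℓ(j)} whenever j ≠ ℓ, where σ^ℓ(i) = i if i < ℓ and σ^ℓ(i) = i + 1 if i > ℓ. In other words, this assignment on generators preserves all the defining relations of B_n. -/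
noncomputable section

open FreeLieAlgebra

/-- The defining relations of the braid Lie algebra `B_n`, as elements of the free Lie
algebra over `ℚ` on the symbols `x_{ij}`, `1 ≤ i, j ≤ n` (here 0-indexed by `Fin n × Fin n`):
(1) `x_{ij} = x_{ji}`; (2) `x_{ii} = 0`; (3) `[x_{ij}, x_{lm}] = 0` when `{i,j} ∩ {l,m} = ∅`;
(4) `[x_{ij}, x_{jl}] = [x_{jl}, x_{li}] = [x_{li}, x_{ij}]` for distinct `i, j, l`. -/
def braidRel (n : ℕ) : Set (FreeLieAlgebra ℚ (Fin n × Fin n)) :=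
  {a | (∃ i j : Fin n, a = of ℚ (i, j) - of ℚ (j, i)) ∨
       (∃ i : Fin n, a = of ℚ (i, i)) ∨
       (∃ i j l m : Fin n, ({i, j} ∩ {l, m} : Set (Fin n)) = ∅ ∧
          a = ⁅of ℚ (i, j), of ℚ (l, m)⁆) ∨
       (∃ i j l : Fin n, i ≠ j ∧ j ≠ l ∧ i ≠ l ∧
          (a = ⁅of ℚ (i, j), of ℚ (j, l)⁆ - ⁅of ℚ (j, l), of ℚ (l, i)⁆ ∨
           a = ⁅of ℚ (j, l), of ℚ (l, i)⁆ - ⁅of ℚ (l, i), of ℚ (i, j)⁆))}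

/-- The Lie ideal generated by the braid relations. -/
def braidIdeal (n : ℕ) : LieIdeal ℚ (FreeLieAlgebra ℚ (Fin n × Fin n)) :=
  LieSubmodule.lieSpan ℚ _ (braidRel n)

/-- The braid Lie algebra `B_n`: the quotient of the free Lie algebra over `ℚ` on the
symbols `x_{ij}`, `1 ≤ i, j ≤ n`, by the Lie ideal generated by the braid relations. -/
abbrev BraidLie (n : ℕ) : Type :=
  FreeLieAlgebra ℚ (Fin n × Fin n) ⧸ braidIdeal n

/-- The class of the generator `x_{ij}` in `B_n`, for `1 ≤ i, j ≤ n`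
(junk value `0` out of range). -/
def xgen (n i j : ℕ) : BraidLie n :=
  if h : 1 ≤ i ∧ i ≤ n ∧ 1 ≤ j ∧ j ≤ n then
    LieSubmodule.Quotient.mk' (braidIdeal n)
      (of ℚ (⟨i - 1, by omega⟩, ⟨j - 1, by omega⟩))
  else 0

/-- `σ^ℓ(i) = i` if `i < ℓ` and `i + 1` if `i > ℓ`. -/
def sigmaMap (ℓ i : ℕ) : ℕ := if i < ℓ then i else i + 1

/-- A family `X i j` of elements of a Lie ring satisfying the braid relations. -/
structure IsBraidFamily {ι L : Type*} [LieRing L] (X : ι → ι → L) : Prop where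
  symm : ∀ i j, X i j = X j i
  diag : ∀ i, X i i = 0
  lie_eq_zero : ∀ i j l m, i ≠ l → i ≠ m → j ≠ l → j ≠ m → ⁅X i j, X l m⁆ = 0
  lie_rotate : ∀ i j l, i ≠ j → j ≠ l → i ≠ l → ⁅X i j, X j l⁆ = ⁅X j l, X l i⁆

/-- The family obtained from `X` by replacing each index by a finite set of indices. -/
def cablingFamily {ι κ L : Type*} [DecidableEq ι] [AddCommMonoid L] (X : κ → κ → L)
    (S : ι → Finset κ) (i j : ι) : L :=
  if i = j then 0 else ∑ a ∈ S i, ∑ b ∈ S j, X a b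

namespace IsBraidFamily

theorem comp {ι κ L : Type*} [LieRing L] {X : κ → κ → L} (hX : IsBraidFamily X)
    {f : ι → κ} (hf : Function.Injective f) : IsBraidFamily fun i j => X (f i) (f j) where
  symm _ _ := hX.symm _ _
  diag _ := hX.diag _
  lie_eq_zero _ _ _ _ h₁ h₂ h₃ h₄ :=
    hX.lie_eq_zero _ _ _ _ (hf.ne h₁) (hf.ne h₂) (hf.ne h₃) (hf.ne h₄)
  lie_rotate _ _ _ h₁ h₂ h₃ := hX.lie_rotate _ _ _ (hf.ne h₁) (hf.ne h₂) (hf.ne h₃)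

section Cabling

variable {ι κ L : Type*} [DecidableEq ι] [LieRing L] {X : κ → κ → L} {S : ι → Finset κ}

theorem lie_cabling (hX : IsBraidFamily X) (hS : ∀ i j, i ≠ j → ∀ a ∈ S i, ∀ b ∈ S j, a ≠ b)
    {i j l : ι} (hij : i ≠ j) (hjl : j ≠ l) (hil : i ≠ l) :
    ⁅cablingFamily X S i j, cablingFamily X S j l⁆ =
      ∑ a ∈ S i, ∑ b ∈ S j, ∑ c ∈ S l, ⁅X a b, X b c⁆ := by
  simp only [cablingFamily, if_neg hij, if_neg hjl, sum_lie]
  simp only [lie_sum]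
  refine Finset.sum_congr rfl fun a ha => Finset.sum_congr rfl fun b hb => ?_
  refine Finset.sum_eq_single_of_mem b hb fun b' hb' hne => Finset.sum_eq_zero fun c hc => ?_
  exact hX.lie_eq_zero _ _ _ _ (hS _ _ hij _ ha _ hb') (hS _ _ hil _ ha _ hc) hne.symm
    (hS _ _ hjl _ hb _ hc)

theorem cabling (hX : IsBraidFamily X)
    (hS : ∀ i j, i ≠ j → ∀ a ∈ S i, ∀ b ∈ S j, a ≠ b) :
    IsBraidFamily (cablingFamily X S) where
  symm i j := by
    by_cases h : i = j
    · rw [h]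
    · rw [cablingFamily, cablingFamily, if_neg h, if_neg (Ne.symm h), Finset.sum_comm]
      exact Finset.sum_congr rfl fun b _ => Finset.sum_congr rfl fun a _ => hX.symm a b
  diag i := if_pos rfl
  lie_eq_zero i j l m hil him hjl hjm := by
    unfold cablingFamily
    split_ifs with hij hlm
    · exact zero_lie _
    · exact zero_lie _
    · exact lie_zero _
    · simp only [sum_lie]
      simp only [lie_sum]
      exact Finset.sum_eq_zero fun a ha => Finset.sum_eq_zero fun b hb =>
        Finset.sum_eq_zero fun c hc => Finset.sum_eq_zero fun d hd =>
          hX.lie_eq_zero _ _ _ _ (hS _ _ hil _ ha _ hc) (hS _ _ him _ ha _ hd)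
            (hS _ _ hjl _ hb _ hc) (hS _ _ hjm _ hb _ hd)
  lie_rotate i j l hij hjl hil := by
    rw [hX.lie_cabling hS hij hjl hil, hX.lie_cabling hS hjl hil.symm hij.symm, Finset.sum_comm]
    refine Finset.sum_congr rfl fun b hb => ?_
    rw [Finset.sum_comm]
    refine Finset.sum_congr rfl fun c hc => Finset.sum_congr rfl fun a ha => ?_
    exact hX.lie_rotate _ _ _ (hS _ _ hij _ ha _ hb) (hS _ _ hjl _ hb _ hc)
      (hS _ _ hil _ ha _ hc)

end Cabling

/-- A braid family indexed by `Fin n` induces a homomorphism out of `B_n`. -/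
theorem exists_hom {L : Type*} [LieRing L] [LieAlgebra ℚ L] {n : ℕ} {X : Fin n → Fin n → L}
    (hX : IsBraidFamily X) :
    ∃ F : BraidLie n →ₗ⁅ℚ⁆ L,
      ∀ i j, F (LieSubmodule.Quotient.mk' (braidIdeal n) (of ℚ (i, j))) = X i j := by
  let φ : FreeLieAlgebra ℚ (Fin n × Fin n) →ₗ⁅ℚ⁆ L := lift ℚ fun p => X p.1 p.2
  have hφ : ∀ i j, φ (of ℚ (i, j)) = X i j := fun i j => lift_of_apply _ _
  have hle : braidIdeal n ≤ φ.ker := by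
    refine LieSubmodule.lieSpan_le.mpr ?_
    rintro a (⟨i, j, rfl⟩ | ⟨i, rfl⟩ | ⟨i, j, l, m, h, rfl⟩ | ⟨i, j, l, hij, hjl, hil, rfl | rfl⟩)
    all_goals
      simp only [SetLike.mem_coe, LieHom.mem_ker, map_sub, LieHom.map_lie, hφ, sub_eq_zero]
    · exact hX.symm i j
    · exact hX.diag i
    · have hd : ∀ a ∈ ({i, j} : Set (Fin n)), ∀ b ∈ ({l, m} : Set (Fin n)), a ≠ b :=
        fun a ha b hb hab => Set.notMem_empty a (h ▸ ⟨ha, hab ▸ hb⟩)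
      exact hX.lie_eq_zero _ _ _ _ (hd _ (by simp) _ (by simp)) (hd _ (by simp) _ (by simp))
        (hd _ (by simp) _ (by simp)) (hd _ (by simp) _ (by simp))
    · exact hX.lie_rotate _ _ _ hij hjl hil
    · exact hX.lie_rotate _ _ _ hjl hil.symm hij.symm
  refine ⟨{ (braidIdeal n).toSubmodule.liftQ (φ : FreeLieAlgebra ℚ (Fin n × Fin n) →ₗ[ℚ] L) hle with
    map_lie' := ?_ }, hφ⟩
  intro x y
  obtain ⟨x, rfl⟩ := LieSubmodule.Quotient.surjective_mk' _ x
  obtain ⟨y, rfl⟩ := LieSubmodule.Quotient.surjective_mk' _ y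
  exact φ.map_lie x y

end IsBraidFamily

theorem braidLie_mk_eq_zero {n : ℕ} {a : FreeLieAlgebra ℚ (Fin n × Fin n)} (ha : a ∈ braidRel n) :
    LieSubmodule.Quotient.mk' (braidIdeal n) a = 0 :=
  (LieSubmodule.Quotient.mk_eq_zero _).mpr (LieSubmodule.subset_lieSpan ha)

theorem xgen_succ {n : ℕ} (i j : Fin n) :
    xgen n (i + 1) (j + 1) = LieSubmodule.Quotient.mk' (braidIdeal n) (of ℚ (i, j)) :=
  dif_pos ⟨by omega, by omega, by omega, by omega⟩

theorem xgen_eq_zero {n i j : ℕ} (h : ¬(1 ≤ i ∧ i ≤ n ∧ 1 ≤ j ∧ j ≤ n)) : xgen n i j = 0 :=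
  dif_neg h

theorem eq_fin_succ_or_outside (n i : ℕ) : (∃ k : Fin n, i = k + 1) ∨ ¬(1 ≤ i ∧ i ≤ n) := by
  by_cases h : 1 ≤ i ∧ i ≤ n
  · exact .inl ⟨⟨i - 1, by omega⟩, by simp only; omega⟩
  · exact .inr h

theorem isBraidFamily_xgen (n : ℕ) : IsBraidFamily (xgen n) where
  symm i j := by
    rcases eq_fin_succ_or_outside n i with ⟨i, rfl⟩ | hi
    · rcases eq_fin_succ_or_outside n j with ⟨j, rfl⟩ | hj
      · rw [xgen_succ, xgen_succ, ← sub_eq_zero, ← map_sub]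
        exact braidLie_mk_eq_zero (.inl ⟨i, j, rfl⟩)
      · rw [xgen_eq_zero (by tauto), xgen_eq_zero (by tauto)]
    · rw [xgen_eq_zero (by tauto), xgen_eq_zero (by tauto)]
  diag i := by
    rcases eq_fin_succ_or_outside n i with ⟨i, rfl⟩ | hi
    · rw [xgen_succ]
      exact braidLie_mk_eq_zero (.inr (.inl ⟨i, rfl⟩))
    · exact xgen_eq_zero (by tauto)
  lie_eq_zero i j l m hil him hjl hjm := by
    rcases eq_fin_succ_or_outside n i with ⟨i, rfl⟩ | hi
    · rcases eq_fin_succ_or_outside n j with ⟨j, rfl⟩ | hj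
      · rcases eq_fin_succ_or_outside n l with ⟨l, rfl⟩ | hl
        · rcases eq_fin_succ_or_outside n m with ⟨m, rfl⟩ | hm
          · rw [xgen_succ, xgen_succ]
            refine braidLie_mk_eq_zero (.inr (.inr (.inl ⟨i, j, l, m, ?_, rfl⟩)))
            ext a
            simp only [Set.mem_inter_iff, Set.mem_insert_iff, Set.mem_singleton_iff,
              Set.mem_empty_iff_false, iff_false]
            rintro ⟨rfl | rfl, rfl | rfl⟩ <;> contradiction
          · rw [xgen_eq_zero (j := m) (by tauto), lie_zero]
        · rw [xgen_eq_zero (i := l) (by tauto), lie_zero]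
      · rw [xgen_eq_zero (j := j) (by tauto), zero_lie]
    · rw [xgen_eq_zero (i := i) (by tauto), zero_lie]
  lie_rotate i j l hij hjl hil := by
    rcases eq_fin_succ_or_outside n i with ⟨i, rfl⟩ | hi
    · rcases eq_fin_succ_or_outside n j with ⟨j, rfl⟩ | hj
      · rcases eq_fin_succ_or_outside n l with ⟨l, rfl⟩ | hl
        · rw [xgen_succ, xgen_succ, xgen_succ, ← sub_eq_zero]
          exact braidLie_mk_eq_zero (.inr (.inr (.inr ⟨i, j, l, fun h => hij (by rw [h]),
            fun h => hjl (by rw [h]), fun h => hil (by rw [h]), .inl rfl⟩)))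
        · rw [xgen_eq_zero (j := l) (by tauto), lie_zero, zero_lie]
      · rw [xgen_eq_zero (j := j) (by tauto), xgen_eq_zero (i := j) (by tauto),
          zero_lie, zero_lie]
    · rw [xgen_eq_zero (i := i) (j := j) (by tauto), xgen_eq_zero (i := l) (j := i) (by tauto),
        zero_lie, lie_zero]

/-- Homomorphisms out of `B_n` are determined by their values on the generators. -/
theorem braidLie_hom_ext {L : Type*} [LieRing L] [LieAlgebra ℚ L] {n : ℕ}
    {F G : BraidLie n →ₗ⁅ℚ⁆ L}
    (h : ∀ i j, 1 ≤ i → i ≤ n → 1 ≤ j → j ≤ n → F (xgen n i j) = G (xgen n i j)) : F = G := by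
  let π : FreeLieAlgebra ℚ (Fin n × Fin n) →ₗ⁅ℚ⁆ BraidLie n :=
    { (LieSubmodule.Quotient.mk' (braidIdeal n) : _ →ₗ[ℚ] BraidLie n) with
      map_lie' := rfl }
  have hcomp : F.comp π = G.comp π := by
    refine FreeLieAlgebra.hom_ext fun ⟨i, j⟩ => ?_
    have := h (i + 1) (j + 1) (by omega) (by omega) (by omega) (by omega)
    rwa [xgen_succ] at this
  ext x
  obtain ⟨x, rfl⟩ := LieSubmodule.Quotient.surjective_mk' _ x
  exact LieHom.congr_fun hcomp x

/-- The set of indices which replace the index `i` under `∂^ℓ`. -/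
def cofaceFiber (ℓ i : ℕ) : Finset ℕ := if i = ℓ then {ℓ, ℓ + 1} else {sigmaMap ℓ i}

theorem cofaceFiber_self (ℓ : ℕ) : cofaceFiber ℓ ℓ = {ℓ, ℓ + 1} := if_pos rfl

theorem cofaceFiber_of_ne {ℓ i : ℕ} (h : i ≠ ℓ) : cofaceFiber ℓ i = {sigmaMap ℓ i} := if_neg h

theorem cofaceFiber_disjoint (ℓ i j : ℕ) (hij : i ≠ j) :
    ∀ a ∈ cofaceFiber ℓ i, ∀ b ∈ cofaceFiber ℓ j, a ≠ b := by
  intro a ha b hb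
  unfold cofaceFiber sigmaMap at ha hb
  split_ifs at ha hb <;> simp only [Finset.mem_insert, Finset.mem_singleton] at ha hb <;> omega

/-- For `n ≥ 1` and `0 ≤ ℓ ≤ n + 1`, there is a (necessarily unique) Lie algebra
homomorphism `∂^ℓ : B_n → B_{n+1}` with `∂^ℓ(x_{ij}) = x_{σ^ℓ(i) σ^ℓ(j)}` for
`i, j ≠ ℓ` and `∂^ℓ(x_{ℓ j}) = x_{ℓ, σ^ℓ(j)} + x_{ℓ+1, σ^ℓ(j)}` for `j ≠ ℓ`; that is,
this assignment on generators preserves all the defining relations of `B_n`. -/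
theorem exists_coface (n : ℕ) (hn : 1 ≤ n) (ℓ : ℕ) (hℓ : ℓ ≤ n + 1) :
    ∃! F : BraidLie n →ₗ⁅ℚ⁆ BraidLie (n + 1),
      (∀ i j : ℕ, 1 ≤ i → i ≤ n → 1 ≤ j → j ≤ n → i ≠ ℓ → j ≠ ℓ →
          F (xgen n i j) = xgen (n + 1) (sigmaMap ℓ i) (sigmaMap ℓ j)) ∧
      (1 ≤ ℓ → ℓ ≤ n → ∀ j : ℕ, 1 ≤ j → j ≤ n → j ≠ ℓ →
          F (xgen n ℓ j) =
            xgen (n + 1) ℓ (sigmaMap ℓ j) + xgen (n + 1) (ℓ + 1) (sigmaMap ℓ j)) := by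
  have hfam := (isBraidFamily_xgen (n + 1)).cabling (cofaceFiber_disjoint ℓ)
  obtain ⟨F, hF⟩ := (hfam.comp (f := fun i : Fin n => (i : ℕ) + 1)
    fun i j h => Fin.ext (Nat.succ_injective h)).exists_hom
  have hFx : ∀ i j, 1 ≤ i → i ≤ n → 1 ≤ j → j ≤ n →
      F (xgen n i j) = cablingFamily (xgen (n + 1)) (cofaceFiber ℓ) i j := by
    intro i j hi hi' hj hj'
    obtain ⟨i, rfl⟩ := (eq_fin_succ_or_outside n i).resolve_right (by tauto)
    obtain ⟨j, rfl⟩ := (eq_fin_succ_or_outside n j).resolve_right (by tauto)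
    rw [xgen_succ, hF]
  refine ⟨F, ⟨fun i j hi hi' hj hj' hiℓ hjℓ => ?_, fun hℓ₁ hℓ₂ j hj hj' hjℓ => ?_⟩, ?_⟩
  · rw [hFx i j hi hi' hj hj']
    by_cases hij : i = j
    · rw [hij, hfam.diag, (isBraidFamily_xgen (n + 1)).diag]
    · rw [cablingFamily, if_neg hij, cofaceFiber_of_ne hiℓ, cofaceFiber_of_ne hjℓ,
        Finset.sum_singleton, Finset.sum_singleton]
  · rw [hFx ℓ j hℓ₁ hℓ₂ hj hj', cablingFamily, if_neg hjℓ.symm, cofaceFiber_self,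
      cofaceFiber_of_ne hjℓ, Finset.sum_pair (Nat.succ_ne_self ℓ).symm, Finset.sum_singleton,
      Finset.sum_singleton]
  · rintro G ⟨hG₁, hG₂⟩
    have hGℓ : ∀ j, 1 ≤ ℓ → ℓ ≤ n → 1 ≤ j → j ≤ n → G (xgen n ℓ j) = F (xgen n ℓ j) := by
      intro j hℓ₁ hℓ₂ hj hj'
      by_cases hjℓ : j = ℓ
      · rw [hjℓ, (isBraidFamily_xgen n).diag, map_zero, map_zero]
      · rw [hG₂ hℓ₁ hℓ₂ j hj hj' hjℓ, hFx ℓ j hℓ₁ hℓ₂ hj hj', cablingFamily,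
          if_neg (Ne.symm hjℓ), cofaceFiber_self, cofaceFiber_of_ne hjℓ,
          Finset.sum_pair (Nat.succ_ne_self ℓ).symm, Finset.sum_singleton, Finset.sum_singleton]
    refine braidLie_hom_ext fun i j hi hi' hj hj' => ?_
    by_cases hiℓ : i = ℓ
    · subst hiℓ
      exact hGℓ j hi hi' hj hj'
    by_cases hjℓ : j = ℓ
    · subst hjℓ
      rw [(isBraidFamily_xgen n).symm i j]
      exact hGℓ i hj hj' hi hi'
    rw [hG₁ i j hi hi' hj hj' hiℓ hjℓ, hFx i j hi hi' hj hj']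
    by_cases hij : i = j
    · rw [hij, hfam.diag, (isBraidFamily_xgen (n + 1)).diag]
    · rw [cablingFamily, if_neg hij, cofaceFiber_of_ne hiℓ, cofaceFiber_of_ne hjℓ,
        Finset.sum_singleton, Finset.sum_singleton]

end
end

section
/- (Cosimplicial coface identities.) For every n ≥ 1 and all indices i, j with 0 ≤ i < j ≤ n+2, the compositions of coface maps satisfy ∂^j ∘ ∂^i = ∂^i ∘ ∂^{j-1} as Lie algebra homomorphisms B_n → B_{n+2}. -/
noncomputable section

open FreeLieAlgebra

/-- `F : B_n → B_{n+1}` is the coface map `∂^ℓ` if `F(x_{ij}) = x_{σ^ℓ(i) σ^ℓ(j)}` for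
`i, j ≠ ℓ` and `F(x_{ℓ j}) = x_{ℓ, σ^ℓ(j)} + x_{ℓ+1, σ^ℓ(j)}` for `j ≠ ℓ`. -/
def IsCoface (n ℓ : ℕ) (F : BraidLie n →ₗ⁅ℚ⁆ BraidLie (n + 1)) : Prop :=
  (∀ i j : ℕ, 1 ≤ i → i ≤ n → 1 ≤ j → j ≤ n → i ≠ ℓ → j ≠ ℓ →
      F (xgen n i j) = xgen (n + 1) (sigmaMap ℓ i) (sigmaMap ℓ j)) ∧
  (1 ≤ ℓ → ℓ ≤ n → ∀ j : ℕ, 1 ≤ j → j ≤ n → j ≠ ℓ →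
      F (xgen n ℓ j) = xgen (n + 1) ℓ (sigmaMap ℓ j) + xgen (n + 1) (ℓ + 1) (sigmaMap ℓ j))

theorem xgen_symm (n i j : ℕ) : xgen n i j = xgen n j i := by
  unfold xgen
  by_cases h : 1 ≤ i ∧ i ≤ n ∧ 1 ≤ j ∧ j ≤ n
  · rw [dif_pos h, dif_pos ⟨h.2.2.1, h.2.2.2, h.1, h.2.1⟩, ← sub_eq_zero, ← map_sub]
    exact (LieSubmodule.Quotient.mk_eq_zero _).2 (LieSubmodule.subset_lieSpan (.inl ⟨_, _, rfl⟩))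
  · rw [dif_neg h, dif_neg (by tauto)]

theorem xgen_self (n i : ℕ) : xgen n i i = 0 := by
  unfold xgen
  split_ifs with h
  · exact (LieSubmodule.Quotient.mk_eq_zero _).2
      (LieSubmodule.subset_lieSpan (.inr (.inl ⟨_, rfl⟩)))
  · rfl

/-- Lie algebra homomorphisms out of `B_n` agree once they agree on the generators `x_{ij}`
with `i ≠ j`. -/
theorem BraidLie.hom_ext {n : ℕ} {L : Type*} [LieRing L] [LieAlgebra ℚ L]
    {F G : BraidLie n →ₗ⁅ℚ⁆ L}
    (h : ∀ i j, 1 ≤ i → i ≤ n → 1 ≤ j → j ≤ n → i ≠ j → F (xgen n i j) = G (xgen n i j)) :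
    F = G := by
  let π : FreeLieAlgebra ℚ (Fin n × Fin n) →ₗ⁅ℚ⁆ BraidLie n :=
    { (LieSubmodule.Quotient.mk' (braidIdeal n) : _ →ₗ[ℚ] BraidLie n) with
      map_lie' := fun {x y} => LieSubmodule.Quotient.mk_bracket (I := braidIdeal n) x y }
  have hπ : F.comp π = G.comp π := by
    refine FreeLieAlgebra.hom_ext fun ⟨i, j⟩ => ?_
    have hx : π (of ℚ (i, j)) = xgen n (i + 1) (j + 1) := by
      rw [xgen, dif_pos ⟨by omega, by omega, by omega, by omega⟩]
      rfl
    rw [LieHom.comp_apply, LieHom.comp_apply, hx]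
    by_cases hij : i = j
    · rw [hij, xgen_self, map_zero, map_zero]
    · exact h _ _ (by omega) (by omega) (by omega) (by omega) (by omega)
  ext x
  obtain ⟨y, rfl⟩ := LieSubmodule.Quotient.surjective_mk' (braidIdeal n) x
  exact LieHom.congr_fun hπ y

/-- The indices into which the coface map `∂^ℓ` splits the index `a`: `{ℓ, ℓ + 1}` for `a = ℓ`,
and `{σ^ℓ(a)}` otherwise. -/
def cofaceIndices (ℓ a : ℕ) : Finset ℕ :=
  if a = ℓ then {ℓ, ℓ + 1} else {sigmaMap ℓ a}

theorem mem_cofaceIndices {ℓ a c : ℕ} :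
    c ∈ cofaceIndices ℓ a ↔ (c = a ∧ a ≤ ℓ) ∨ (c = a + 1 ∧ ℓ ≤ a) := by
  unfold cofaceIndices sigmaMap
  split_ifs <;> simp <;> omega

theorem IsCoface.apply_xgen {n ℓ : ℕ} {F : BraidLie n →ₗ⁅ℚ⁆ BraidLie (n + 1)}
    (hF : IsCoface n ℓ F) {a b : ℕ} (ha : 1 ≤ a) (ha' : a ≤ n) (hb : 1 ≤ b) (hb' : b ≤ n)
    (hab : a ≠ b) :
    F (xgen n a b) =
      ∑ c ∈ cofaceIndices ℓ a, ∑ d ∈ cofaceIndices ℓ b, xgen (n + 1) c d := by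
  unfold cofaceIndices
  by_cases h : a = ℓ
  · subst h
    simp [hab.symm, hF.2 ha ha' b hb hb' hab.symm]
  by_cases h' : b = ℓ
  · subst h'
    rw [xgen_symm, hF.2 hb hb' a ha ha' hab]
    simp [hab, xgen_symm _ (sigmaMap b a)]
  · simp [h, h', hF.1 a b ha ha' hb hb' h h']

theorem sum_cofaceIndices_comm {M : Type*} [AddCommMonoid M] {i j : ℕ} (hij : i < j) (a : ℕ)
    (f : ℕ → M) :
    ∑ c ∈ cofaceIndices i a, ∑ e ∈ cofaceIndices j c, f e =
      ∑ c ∈ cofaceIndices (j - 1) a, ∑ e ∈ cofaceIndices i c, f e := by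
  have hdisj (k l : ℕ) : (cofaceIndices k a : Set ℕ).PairwiseDisjoint (cofaceIndices l) := by
    intro c _ d _ hcd
    refine Finset.disjoint_left.2 fun e hc hd => ?_
    rw [mem_cofaceIndices] at hc hd
    omega
  rw [← Finset.sum_biUnion (hdisj i j), ← Finset.sum_biUnion (hdisj (j - 1) i)]
  congr 1
  ext e
  simp only [Finset.mem_biUnion, mem_cofaceIndices]
  constructor
  · rintro ⟨c, h, h'⟩
    by_cases he : e ≤ i
    · exact ⟨e, by omega, by omega⟩
    · exact ⟨e - 1, by omega, by omega⟩
  · rintro ⟨c, h, h'⟩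
    by_cases he : e ≤ j
    · exact ⟨e, by omega, by omega⟩
    · exact ⟨e - 1, by omega, by omega⟩

/-- The composite of two coface maps on a generator, as a sum over indices. -/
theorem IsCoface.apply_apply_xgen {n k l : ℕ} {F : BraidLie n →ₗ⁅ℚ⁆ BraidLie (n + 1)}
    {G : BraidLie (n + 1) →ₗ⁅ℚ⁆ BraidLie (n + 2)} (hF : IsCoface n k F)
    (hG : IsCoface (n + 1) l G) {a b : ℕ} (ha : 1 ≤ a) (ha' : a ≤ n) (hb : 1 ≤ b) (hb' : b ≤ n)
    (hab : a ≠ b) :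
    G (F (xgen n a b)) =
      ∑ c ∈ cofaceIndices k a, ∑ e ∈ cofaceIndices l c,
        ∑ d ∈ cofaceIndices k b, ∑ f ∈ cofaceIndices l d, xgen (n + 2) e f := by
  rw [hF.apply_xgen ha ha' hb hb' hab, map_sum]
  refine Finset.sum_congr rfl fun c hc => ?_
  rw [map_sum, Finset.sum_comm]
  refine Finset.sum_congr rfl fun d hd => ?_
  rw [mem_cofaceIndices] at hc hd
  exact hG.apply_xgen (by omega) (by omega) (by omega) (by omega) (by omega)

/-- The cosimplicial coface identities: for `0 ≤ i < j ≤ n + 2`,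
`∂^j ∘ ∂^i = ∂^i ∘ ∂^{j-1}` as Lie algebra homomorphisms `B_n → B_{n+2}`. -/
theorem coface_identities (n : ℕ) (hn : 1 ≤ n) (i j : ℕ) (hij : i < j) (hj : j ≤ n + 2)
    (Di : BraidLie n →ₗ⁅ℚ⁆ BraidLie (n + 1)) (hDi : IsCoface n i Di)
    (Dj : BraidLie (n + 1) →ₗ⁅ℚ⁆ BraidLie (n + 2)) (hDj : IsCoface (n + 1) j Dj)
    (Dj' : BraidLie n →ₗ⁅ℚ⁆ BraidLie (n + 1)) (hDj' : IsCoface n (j - 1) Dj')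
    (Di' : BraidLie (n + 1) →ₗ⁅ℚ⁆ BraidLie (n + 2)) (hDi' : IsCoface (n + 1) i Di') :
    Dj.comp Di = Di'.comp Dj' := by
  refine BraidLie.hom_ext fun a b ha ha' hb hb' hab => ?_
  rw [LieHom.comp_apply, LieHom.comp_apply, hDi.apply_apply_xgen hDj ha ha' hb hb' hab,
    hDj'.apply_apply_xgen hDi' ha ha' hb hb' hab, sum_cofaceIndices_comm hij a]
  simp only [sum_cofaceIndices_comm hij b]

end
end

section
/- For every n ≥ 2, the kernel of the codegeneracy map φ^n : B_n → B_{n-1} is equal to the Lie subalgebra of B_n generated by the elements x_{1n}, x_{2n}, …, x_{n-1,n}. -/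
noncomputable section

open FreeLieAlgebra

/-- `τ^ℓ(i) = i` if `i < ℓ` and `i - 1` if `i > ℓ`. -/
def tauMap (ℓ i : ℕ) : ℕ := if i < ℓ then i else i - 1

/-- `F : B_n → B_{n-1}` is the codegeneracy map `φ^ℓ` if `F(x_{ij}) = x_{τ^ℓ(i) τ^ℓ(j)}`
for `i, j ≠ ℓ` and `F(x_{ij}) = 0` when `i = ℓ` or `j = ℓ`. -/
def IsCodegeneracy (n ℓ : ℕ) (F : BraidLie n →ₗ⁅ℚ⁆ BraidLie (n - 1)) : Prop :=
  (∀ i j : ℕ, 1 ≤ i → i ≤ n → 1 ≤ j → j ≤ n → i ≠ ℓ → j ≠ ℓ →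
      F (xgen n i j) = xgen (n - 1) (tauMap ℓ i) (tauMap ℓ j)) ∧
  (∀ i j : ℕ, 1 ≤ i → i ≤ n → 1 ≤ j → j ≤ n → (i = ℓ ∨ j = ℓ) →
      F (xgen n i j) = 0)

/-- The projection from the free Lie algebra onto `B_n`, as a Lie algebra homomorphism. -/
def braidMk (n : ℕ) : FreeLieAlgebra ℚ (Fin n × Fin n) →ₗ⁅ℚ⁆ BraidLie n :=
  { (LieSubmodule.Quotient.mk' (braidIdeal n) : _ →ₗ[ℚ] BraidLie n) with
    map_lie' := fun {x y} => LieSubmodule.Quotient.mk_bracket (I := braidIdeal n) x y }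

theorem braidMk_surjective (n : ℕ) : Function.Surjective (braidMk n) :=
  LieSubmodule.Quotient.surjective_mk' (braidIdeal n)

theorem braidMk_eq_zero {n : ℕ} {a : FreeLieAlgebra ℚ (Fin n × Fin n)} :
    braidMk n a = 0 ↔ a ∈ braidIdeal n :=
  LieSubmodule.Quotient.mk_eq_zero (N := braidIdeal n)

theorem braidMk_eq_zero_of_mem_braidRel {n : ℕ} {a : FreeLieAlgebra ℚ (Fin n × Fin n)}
    (ha : a ∈ braidRel n) : braidMk n a = 0 :=
  braidMk_eq_zero.2 (LieSubmodule.subset_lieSpan ha)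

/-- The generator `x_{ij}` of `B_n`, indexed by `Fin n`. -/
def braidGen {n : ℕ} (i j : Fin n) : BraidLie n := braidMk n (of ℚ (i, j))

theorem braidGen_comm {n : ℕ} (i j : Fin n) : braidGen i j = braidGen j i := by
  have h := braidMk_eq_zero_of_mem_braidRel (n := n) (Or.inl ⟨i, j, rfl⟩)
  rwa [map_sub, sub_eq_zero] at h

theorem braidGen_self {n : ℕ} (i : Fin n) : braidGen i i = 0 :=
  braidMk_eq_zero_of_mem_braidRel (Or.inr (Or.inl ⟨i, rfl⟩))

theorem lie_braidGen_of_disjoint {n : ℕ} {i j l m : Fin n}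
    (h : ({i, j} ∩ {l, m} : Set (Fin n)) = ∅) : ⁅braidGen i j, braidGen l m⁆ = 0 := by
  have h := braidMk_eq_zero_of_mem_braidRel (Or.inr (Or.inr (Or.inl ⟨i, j, l, m, h, rfl⟩)))
  rwa [LieHom.map_lie] at h

theorem lie_braidGen_rotate {n : ℕ} {i j l : Fin n} (hij : i ≠ j) (hjl : j ≠ l) (hil : i ≠ l) :
    ⁅braidGen i j, braidGen j l⁆ = ⁅braidGen j l, braidGen l i⁆ := by
  have h := braidMk_eq_zero_of_mem_braidRel
    (Or.inr (Or.inr (Or.inr ⟨i, j, l, hij, hjl, hil, Or.inl rfl⟩)))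
  rwa [map_sub, sub_eq_zero, LieHom.map_lie, LieHom.map_lie] at h

theorem xgen_eq_braidGen {n i j : ℕ} (hi : i < n) (hj : j < n) :
    xgen n (i + 1) (j + 1) = braidGen ⟨i, hi⟩ ⟨j, hj⟩ :=
  dif_pos (⟨by omega, hi, by omega, hj⟩ : 1 ≤ i + 1 ∧ i + 1 ≤ n ∧ 1 ≤ j + 1 ∧ j + 1 ≤ n)

/-- A Lie subalgebra of a free Lie algebra containing the generators is everything. -/
theorem mem_of_forall_of_mem {R X : Type*} [CommRing R] (T : LieSubalgebra R (FreeLieAlgebra R X))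
    (hT : ∀ x, of R x ∈ T) (a : FreeLieAlgebra R X) : a ∈ T := by
  have h : T.incl.comp (lift R fun x => (⟨of R x, hT x⟩ : T)) = LieHom.id :=
    hom_ext fun x => by simp
  have ha := LieHom.congr_fun h a
  rw [LieHom.comp_apply, LieHom.id_apply] at ha
  exact ha ▸ (lift R (fun x => (⟨of R x, hT x⟩ : T)) a).2

theorem mem_of_forall_braidGen_mem {n : ℕ} (T : LieSubalgebra ℚ (BraidLie n))
    (hT : ∀ i j, braidGen i j ∈ T) (y : BraidLie n) : y ∈ T := by
  obtain ⟨a, rfl⟩ := braidMk_surjective n y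
  exact mem_of_forall_of_mem (T.comap (braidMk n)) (fun x => hT x.1 x.2) a

/-- The homomorphism from the free Lie algebra to `B_{m+1}` sending the symbol `x_{ij}`,
`i, j ≤ m`, to the generator `x_{ij}`. It factors through `B_m`. -/
def braidSection (m : ℕ) : FreeLieAlgebra ℚ (Fin m × Fin m) →ₗ⁅ℚ⁆ BraidLie (m + 1) :=
  lift ℚ fun x => braidGen x.1.castSucc x.2.castSucc

theorem braidSection_of {m : ℕ} (i j : Fin m) :
    braidSection m (of ℚ (i, j)) = braidGen i.castSucc j.castSucc :=
  lift_of_apply _ _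

theorem braidSection_eq_zero_of_mem {m : ℕ} {b : FreeLieAlgebra ℚ (Fin m × Fin m)}
    (hb : b ∈ braidIdeal m) : braidSection m b = 0 := by
  suffices h : braidIdeal m ≤ (braidSection m).ker from
    (LieHom.mem_ker (f := braidSection m)).1 (h hb)
  refine LieSubmodule.lieSpan_le.2 ?_
  intro a ha
  refine (LieHom.mem_ker (f := braidSection m)).2 ?_
  rcases ha with ⟨i, j, rfl⟩ | ⟨i, rfl⟩ | ⟨i, j, l, k, h, rfl⟩ | ⟨i, j, l, hij, hjl, hil, rfl | rfl⟩
  · rw [map_sub, braidSection_of, braidSection_of, braidGen_comm, sub_self]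
  · rw [braidSection_of, braidGen_self]
  · rw [LieHom.map_lie, braidSection_of, braidSection_of]
    refine lie_braidGen_of_disjoint ?_
    simpa [Set.image_inter (Fin.castSucc_injective m), Set.image_pair] using
      congrArg (Set.image Fin.castSucc) h
  · simp only [map_sub, LieHom.map_lie, braidSection_of]
    rw [sub_eq_zero]
    exact lie_braidGen_rotate (by simpa) (by simpa) (by simpa)
  · simp only [map_sub, LieHom.map_lie, braidSection_of]
    rw [sub_eq_zero]
    exact lie_braidGen_rotate (by simpa) (by simpa using hil.symm) (by simpa using hij.symm)

/-- The Lie subalgebra of `B_{m+1}` generated by the `x_{i,m+1}`. -/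
def lastSpan (m : ℕ) : LieSubalgebra ℚ (BraidLie (m + 1)) :=
  LieSubalgebra.lieSpan ℚ _ (Set.range fun i : Fin m => braidGen i.castSucc (Fin.last m))

theorem braidGen_last_mem {m : ℕ} (i : Fin (m + 1)) : braidGen i (Fin.last m) ∈ lastSpan m := by
  induction i using Fin.lastCases with
  | last => rw [braidGen_self]; exact zero_mem _
  | cast i => exact LieSubalgebra.subset_lieSpan ⟨i, rfl⟩

theorem lie_braidGen_last_mem {m : ℕ} (i j k : Fin m) :
    ⁅braidGen i.castSucc j.castSucc, braidGen k.castSucc (Fin.last m)⁆ ∈ lastSpan m := by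
  have key (i j : Fin m) (hij : i ≠ j) :
      ⁅braidGen i.castSucc j.castSucc, braidGen j.castSucc (Fin.last m)⁆ ∈ lastSpan m := by
    rw [lie_braidGen_rotate (by simpa) (Fin.castSucc_ne_last j) (Fin.castSucc_ne_last i),
      braidGen_comm (Fin.last m)]
    exact LieSubalgebra.lie_mem _ (braidGen_last_mem _) (braidGen_last_mem _)
  by_cases hij : i = j
  · rw [hij, braidGen_self, zero_lie]; exact zero_mem _
  by_cases hjk : j = k
  · exact hjk ▸ key i j hij
  by_cases hik : i = k
  · rw [braidGen_comm i.castSucc]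
    exact hik ▸ key j i (Ne.symm hij)
  rw [lie_braidGen_of_disjoint]
  · exact zero_mem _
  · ext x
    simp only [Set.mem_inter_iff, Set.mem_insert_iff, Set.mem_singleton_iff,
      Set.mem_empty_iff_false, iff_false, not_and, not_or]
    rintro (rfl | rfl)
    · exact ⟨by simpa, Fin.castSucc_ne_last i⟩
    · exact ⟨by simpa, Fin.castSucc_ne_last j⟩

/-- The Lie subalgebra generated by the `x_{i,m+1}` is an ideal of `B_{m+1}`. -/
theorem lie_mem_lastSpan {m : ℕ} (y : BraidLie (m + 1)) {x : BraidLie (m + 1)}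
    (hx : x ∈ lastSpan m) : ⁅y, x⁆ ∈ lastSpan m := by
  suffices h : y ∈ (lastSpan m).normalizer from (LieSubalgebra.mem_normalizer_iff _ _).1 h x hx
  refine mem_of_forall_braidGen_mem _ (fun i j => ?_) y
  induction j using Fin.lastCases with
  | last => exact LieSubalgebra.le_normalizer _ (braidGen_last_mem i)
  | cast j =>
    induction i using Fin.lastCases with
    | last =>
      rw [braidGen_comm]
      exact LieSubalgebra.le_normalizer _ (braidGen_last_mem _)
    | cast i =>
      refine (LieSubalgebra.mem_normalizer_iff _ _).2 fun x hx => ?_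
      induction hx using LieSubalgebra.lieSpan_induction with
      | mem x hx => obtain ⟨k, rfl⟩ := hx; exact lie_braidGen_last_mem i j k
      | zero => rw [lie_zero]; exact zero_mem _
      | add u v _ _ hu hv => rw [lie_add]; exact add_mem hu hv
      | smul t u _ hu => rw [lie_smul]; exact LieSubalgebra.smul_mem _ t hu
      | lie u v hu' hv' hu hv =>
        rw [leibniz_lie]
        exact add_mem (LieSubalgebra.lie_mem _ hu hv') (LieSubalgebra.lie_mem _ hu' hv)

/-- The elements of `B_{m+1}` that agree modulo `lastSpan m` with the image under `braidSection`
of a representative of their image under `F`. -/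
def sectionAgree {m : ℕ} (F : BraidLie (m + 1) →ₗ⁅ℚ⁆ BraidLie m) :
    LieSubalgebra ℚ (BraidLie (m + 1)) where
  carrier := {y | ∃ b, F y = braidMk m b ∧ y - braidSection m b ∈ lastSpan m}
  zero_mem' := ⟨0, by simp, by simp⟩
  add_mem' := by
    rintro x y ⟨a, ha, ha'⟩ ⟨b, hb, hb'⟩
    refine ⟨a + b, by rw [map_add, map_add, ha, hb], ?_⟩
    rw [map_add, add_sub_add_comm]
    exact add_mem ha' hb'
  smul_mem' := by
    rintro t x ⟨a, ha, ha'⟩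
    refine ⟨t • a, by rw [map_smul, map_smul, ha], ?_⟩
    rw [map_smul, ← smul_sub]
    exact LieSubalgebra.smul_mem _ t ha'
  lie_mem' := by
    rintro x y ⟨a, ha, ha'⟩ ⟨b, hb, hb'⟩
    refine ⟨⁅a, b⁆, by rw [LieHom.map_lie, LieHom.map_lie, ha, hb], ?_⟩
    have h : ⁅x, y⁆ - braidSection m ⁅a, b⁆ =
        ⁅braidSection m a, y - braidSection m b⁆ - ⁅y, x - braidSection m a⁆ := by
      rw [LieHom.map_lie, lie_sub, lie_sub, ← lie_skew y x, ← lie_skew y (braidSection m a)]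
      abel
    rw [h]
    exact sub_mem (lie_mem_lastSpan _ hb') (lie_mem_lastSpan _ ha')

theorem eq_zero_iff_mem_lastSpan {m : ℕ} (F : BraidLie (m + 1) →ₗ⁅ℚ⁆ BraidLie m)
    (hF : ∀ i j : Fin m, F (braidGen i.castSucc j.castSucc) = braidGen i j)
    (hF_last : ∀ i : Fin (m + 1), F (braidGen i (Fin.last m)) = 0) (y : BraidLie (m + 1)) :
    F y = 0 ↔ y ∈ lastSpan m := by
  constructor
  · intro hy
    have h : y ∈ sectionAgree F := by
      have hlast (i : Fin (m + 1)) : braidGen i (Fin.last m) ∈ sectionAgree F :=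
        ⟨0, by rw [hF_last, map_zero],
          by rw [map_zero, sub_zero]; exact braidGen_last_mem i⟩
      refine mem_of_forall_braidGen_mem _ (fun i j => ?_) y
      induction j using Fin.lastCases with
      | last => exact hlast i
      | cast j =>
        induction i using Fin.lastCases with
        | last => rw [braidGen_comm]; exact hlast _
        | cast i =>
          exact ⟨of ℚ (i, j), hF i j, by rw [braidSection_of, sub_self]; exact zero_mem _⟩
    obtain ⟨b, hb, hb'⟩ := h
    rwa [braidSection_eq_zero_of_mem (braidMk_eq_zero.1 (hb.symm.trans hy)), sub_zero] at hb'
  · intro hy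
    have h : lastSpan m ≤ F.ker.toLieSubalgebra :=
      LieSubalgebra.lieSpan_le.2 <| by
        rintro _ ⟨i, rfl⟩
        exact (LieHom.mem_ker (f := F)).2 (hF_last _)
    exact (LieHom.mem_ker (f := F)).1 (h hy)

/-- For `n ≥ 2`, the kernel of the codegeneracy map `φ^n : B_n → B_{n-1}` is the Lie
subalgebra of `B_n` generated by the elements `x_{1n}, …, x_{n-1,n}`. -/
theorem ker_codegeneracy_eq_span (n : ℕ) (hn : 2 ≤ n)
    (F : BraidLie n →ₗ⁅ℚ⁆ BraidLie (n - 1)) (hF : IsCodegeneracy n n F) :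
    ∀ y : BraidLie n, F y = 0 ↔
      y ∈ LieSubalgebra.lieSpan ℚ (BraidLie n)
        {x | ∃ i : ℕ, 1 ≤ i ∧ i ≤ n - 1 ∧ x = xgen n i n} := by
  obtain ⟨m, rfl⟩ : ∃ m, n = m + 1 := ⟨n - 1, by omega⟩
  intro y
  have hset : {x | ∃ i : ℕ, 1 ≤ i ∧ i ≤ m + 1 - 1 ∧ x = xgen (m + 1) i (m + 1)} =
      Set.range fun i : Fin m => braidGen i.castSucc (Fin.last m) := by
    ext x
    constructor
    · rintro ⟨i, hi, him, rfl⟩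
      obtain ⟨i, rfl⟩ : ∃ k, i = k + 1 := ⟨i - 1, by omega⟩
      exact ⟨⟨i, by omega⟩, (xgen_eq_braidGen (by omega) (by omega)).symm⟩
    · rintro ⟨i, rfl⟩
      exact ⟨i + 1, by omega, by omega, (xgen_eq_braidGen (by omega) (by omega)).symm⟩
  rw [hset]
  refine eq_zero_iff_mem_lastSpan F (fun i j => ?_) (fun i => ?_) y
  · have h := hF.1 (i + 1) (j + 1) (by omega) (by omega) (by omega) (by omega) (by omega) (by omega)
    rw [tauMap, tauMap, if_pos (by omega), if_pos (by omega),
      xgen_eq_braidGen (by omega) (by omega)] at h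
    exact h.trans (xgen_eq_braidGen i.2 j.2)
  · have h := hF.2 (i + 1) (m + 1) (by omega) (by omega) (by omega) (by omega) (Or.inr rfl)
    rwa [xgen_eq_braidGen i.2 (by omega)] at h

end
end
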